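/- arXiv:1512.02171 — 2 statements merged into one kernel-verified Lean document; each statement's English description precedes it below -/
import Mathlib

section
/- Let p ≥ 0 and let σ be a permutation of length n. Then σ belongs to the basis Bₚ if and only if the following four conditions hold: (i) σ has exactly p+1 non-left-to-right-maxima; (ii) the value n−1 is a non-left-to-right-maximum of σ; (iii) the value σ₂ is a non-left-to-right-maximum of σ; (iv) for any three left-to-right maxima σᵢ, σⱼ, σ_k of σ with positions i < j < k such that no position strictly between i and k other than j carries a left-to-right maximum, there exists a non-left-to-right-maximum σ_t with j < t < k and σ_t > σᵢ. -/
/-- The word `σ₁σ₂…σₙ` of a permutation of `{1,…,n}` (0-indexed). -/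
def permWord {n : ℕ} (σ : Equiv.Perm (Fin n)) : List (Fin n) :=
  List.ofFn (fun i => σ i)

/-- `β` is obtained from `α` by one right-jump: one entry is removed and
reinserted at a strictly later position. -/
def RightJump {n : ℕ} (α β : Equiv.Perm (Fin n)) : Prop :=
  ∃ (l₁ l₂ l₃ : List (Fin n)) (a : Fin n), l₂ ≠ [] ∧
    permWord α = l₁ ++ a :: (l₂ ++ l₃) ∧
    permWord β = l₁ ++ (l₂ ++ a :: l₃)

/-- `ReachIn p α β` : `β` is obtained from `α` by a sequence of exactly `p` right-jumps. -/
def ReachIn {n : ℕ} : ℕ → Equiv.Perm (Fin n) → Equiv.Perm (Fin n) → Prop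
  | 0, α, β => α = β
  | p + 1, α, β => ∃ γ, RightJump α γ ∧ ReachIn p γ β

/-- `σᵢ` is a left-to-right maximum of `σ`. -/
def IsLtrMax {n : ℕ} (σ : Equiv.Perm (Fin n)) (i : Fin n) : Prop :=
  ∀ j, j ≤ i → σ j ≤ σ i

/-- The number of non-left-to-right-maxima of `σ`. -/
noncomputable def nonLtrMaxCount {n : ℕ} (σ : Equiv.Perm (Fin n)) : ℕ :=
  {i : Fin n | ¬ IsLtrMax σ i}.ncard

/-- `π` is a pattern of `σ` (`π ≺ σ`): `σ` has a subsequence order-isomorphic to `π`. -/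
def IsPattern {k n : ℕ} (π : Equiv.Perm (Fin k)) (σ : Equiv.Perm (Fin n)) : Prop :=
  ∃ f : Fin k → Fin n, StrictMono f ∧ ∀ i j : Fin k, π i < π j ↔ σ (f i) < σ (f j)

/-- `σ ∈ Cₚ` : `σ` is obtainable from the identity by at most `p` right-jumps. -/
def InC (p : ℕ) {n : ℕ} (σ : Equiv.Perm (Fin n)) : Prop :=
  ∃ q ≤ p, ReachIn q 1 σ

/-- `σ ∈ Bₚ`, the basis of `Cₚ`: `σ ∉ Cₚ` and every pattern `π ≺ σ` with `π ≠ σ`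
(equivalently, of length `≠ n`) belongs to `Cₚ`. -/
def InBasis (p : ℕ) {n : ℕ} (σ : Equiv.Perm (Fin n)) : Prop :=
  ¬ InC p σ ∧ ∀ (k : ℕ) (π : Equiv.Perm (Fin k)), IsPattern π σ → k ≠ n → InC p π

/-- `b_{n,p}`: the number of basis permutations of length `n` in `Bₚ`. -/
noncomputable def bnp (n p : ℕ) : ℕ :=
  Nat.card {σ : Equiv.Perm (Fin n) // InBasis p σ}

theorem aux_not {n : ℕ} (σ : Equiv.Perm (Fin n)) (t : Fin n) :
    ¬ IsLtrMax σ t ↔ ∃ s, s < t ∧ σ t < σ s := by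
  unfold IsLtrMax
  push Not
  constructor
  · rintro ⟨s, h1, h2⟩
    refine ⟨s, lt_of_le_of_ne h1 ?_, h2⟩
    rintro rfl
    exact lt_irrefl _ h2
  · rintro ⟨s, h1, h2⟩
    exact ⟨s, h1.le, h2⟩

theorem aux_pair_cons {α : Type*} (w v a : α) (l : List α) :
    [w, v].Sublist (a :: l) ↔ [w, v].Sublist l ∨ (w = a ∧ v ∈ l) := by
  constructor
  · intro h
    cases h with
    | cons _ h => exact Or.inl h
    | cons_cons _ h => exact Or.inr ⟨rfl, List.singleton_sublist.1 h⟩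
  · rintro (h | ⟨rfl, h⟩)
    · exact h.cons _
    · exact (List.singleton_sublist.2 h).cons_cons _

theorem aux_pair_append {α : Type*} (w v : α) (l m : List α) :
    [w, v].Sublist (l ++ m) ↔ [w, v].Sublist l ∨ (w ∈ l ∧ v ∈ m) ∨ [w, v].Sublist m := by
  induction l with
  | nil => simp
  | cons a l ih =>
    rw [List.cons_append, aux_pair_cons, ih, aux_pair_cons, List.mem_append, List.mem_cons]
    tauto

theorem aux_pair_word {n : ℕ} (σ : Equiv.Perm (Fin n)) (i j : Fin n) :
    [σ i, σ j].Sublist (permWord σ) ↔ i < j := by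
  have key : ∀ i j : Fin n, i < j → [σ i, σ j].Sublist (permWord σ) := by
    intro i j h
    have h1 : [i, j].Sublist (List.finRange n) := by
      have hp : List.Pairwise (· < ·) [i, j] := by simpa using h
      exact List.sublist_of_subperm_of_pairwise (r := (· < ·))
        (List.subperm_of_subset (by simpa using h.ne) (by intro x; simp)) hp
        (List.pairwise_lt_finRange n)
    have := h1.map σ
    rwa [← List.ofFn_eq_map] at this
  constructor
  · intro h
    have hp : List.Pairwise (fun a b => σ.symm a < σ.symm b) (permWord σ) := by
      unfold permWord
      rw [List.pairwise_ofFn]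
      intro i j h
      simpa using h
    have := hp.sublist h
    simpa using this
  · exact key i j

def nlv {n : ℕ} (l : List (Fin n)) : Set (Fin n) := {v | ∃ w, v < w ∧ [w, v].Sublist l}

theorem aux_count {n : ℕ} (σ : Equiv.Perm (Fin n)) :
    nonLtrMaxCount σ = (nlv (permWord σ)).ncard := by
  have : nlv (permWord σ) = σ '' {i | ¬ IsLtrMax σ i} := by
    ext v
    obtain ⟨i, rfl⟩ := σ.surjective v
    simp only [nlv, Set.mem_ofPred_eq, Set.mem_image, aux_not]
    constructor
    · rintro ⟨w, h1, h2⟩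
      obtain ⟨j, rfl⟩ := σ.surjective w
      exact ⟨i, ⟨j, (aux_pair_word σ j i).1 h2, h1⟩, rfl⟩
    · rintro ⟨i', ⟨j, h1, h2⟩, h⟩
      obtain rfl := σ.injective h
      exact ⟨σ j, h2, (aux_pair_word σ j i').2 h1⟩
  rw [this, Set.ncard_image_of_injective _ σ.injective]
  rfl

theorem aux_jump {n : ℕ} {α β : Equiv.Perm (Fin n)} (h : RightJump α β) :
    nonLtrMaxCount β ≤ nonLtrMaxCount α + 1 := by
  obtain ⟨l₁, l₂, l₃, a, -, h1, h2⟩ := h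
  rw [aux_count, aux_count, h1, h2]
  refine le_trans (Set.ncard_le_ncard (t := insert a (nlv (l₁ ++ a :: (l₂ ++ l₃)))) ?_)
    (Set.ncard_insert_le _ _)
  rintro v ⟨w, hw, hs⟩
  by_cases hv : v = a
  · exact Or.inl hv
  · refine Or.inr ⟨w, hw, ?_⟩
    simp only [aux_pair_append, aux_pair_cons, List.mem_append, List.mem_cons] at hs ⊢
    tauto

theorem aux_reach {n : ℕ} (q : ℕ) : ∀ (α β : Equiv.Perm (Fin n)), ReachIn q α β →
    nonLtrMaxCount β ≤ nonLtrMaxCount α + q := by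
  induction q with
  | zero => intro α β h; obtain rfl : α = β := h; simp
  | succ q ih =>
    rintro α β ⟨γ, h1, h2⟩
    have := ih _ _ h2
    have := aux_jump h1
    omega

theorem aux_reach_snoc {n : ℕ} (q : ℕ) : ∀ (α γ β : Equiv.Perm (Fin n)), ReachIn q α γ →
    RightJump γ β → ReachIn (q + 1) α β := by
  induction q with
  | zero => intro α γ β h h'; obtain rfl : α = γ := h; exact ⟨β, h', rfl⟩
  | succ q ih =>
    rintro α γ β ⟨δ, h1, h2⟩ h'
    exact ⟨δ, h1, ih _ _ _ h2 h'⟩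

theorem aux_ofList {n : ℕ} (l : List (Fin n)) (h : l.Nodup) (hl : l.length = n) :
    ∃ γ : Equiv.Perm (Fin n), permWord γ = l := by
  have hinj : Function.Injective (fun i : Fin n => l.get (i.cast hl.symm)) := by
    intro i j hij
    have := h.injective_get hij
    simpa using this
  refine ⟨Equiv.ofBijective _ (Finite.injective_iff_bijective.1 hinj), ?_⟩
  apply List.ext_get
  · simp [permWord, hl]
  · intro k h1 h2
    simp [permWord]

set_option maxHeartbeats 1000000 in
theorem aux_back {n : ℕ} (σ : Equiv.Perm (Fin n)) (h : nonLtrMaxCount σ ≠ 0) :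
    ∃ γ, RightJump γ σ ∧ nonLtrMaxCount γ + 1 ≤ nonLtrMaxCount σ := by
  rw [aux_count] at h
  obtain ⟨a, ha⟩ := Set.nonempty_of_ncard_ne_zero h
  have ha' := ha
  obtain ⟨b, hb, hs⟩ := ha
  have hnd : (permWord σ).Nodup := List.nodup_ofFn.2 σ.injective
  have hlen : (permWord σ).length = n := by simp [permWord]
  obtain ⟨m, l₃, hm⟩ := List.append_of_mem (hs.subset (by simp : a ∈ [b, a]))
  have hbm : b ∈ m := by
    rw [hm] at hs hnd
    simp only [aux_pair_append, aux_pair_cons] at hs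
    have h1 : a ∉ m ∧ a ∉ l₃ := by
      simp only [List.nodup_append, List.nodup_cons] at hnd
      exact ⟨fun h => hnd.2.2 a h a (by simp) rfl, hnd.2.1.1⟩
    rcases hs with hs | hs | hs | hs
    · exact absurd (hs.subset (by simp)) h1.1
    · exact hs.1
    · exact absurd (hs.subset (by simp)) h1.2
    · exact absurd hs.2 h1.2
  obtain ⟨l₁, l₂, x, hx, hmm, hl₁⟩ : ∃ l₁ l₂ x, a < x ∧ m = l₁ ++ x :: l₂ ∧ ∀ y ∈ l₁, y ≤ a := by
    clear hm hnd hs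
    induction m with
    | nil => simp at hbm
    | cons c m ih =>
      by_cases hc : a < c
      · exact ⟨[], m, c, hc, rfl, by simp⟩
      · rcases List.mem_cons.1 hbm with rfl | hbm
        · exact absurd hb hc
        · obtain ⟨l₁, l₂, x, hx, hmm, hl₁⟩ := ih hbm
          refine ⟨c :: l₁, l₂, x, hx, by simp [hmm], ?_⟩
          intro y hy
          rcases List.mem_cons.1 hy with rfl | hy
          · exact not_lt.1 hc
          · exact hl₁ y hy
  have hw : permWord σ = l₁ ++ ((x :: l₂) ++ a :: l₃) := by rw [hm, hmm]; simp
  have hperm : (permWord σ).Perm (l₁ ++ a :: ((x :: l₂) ++ l₃)) := by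
    rw [hw]
    exact List.Perm.append_left _ List.perm_middle
  have hnd' := hperm.nodup_iff.1 hnd
  obtain ⟨γ, hγ⟩ := aux_ofList _ hnd' (hperm.length_eq ▸ hlen)
  refine ⟨γ, ⟨l₁, x :: l₂, l₃, a, by simp, hγ, hw⟩, ?_⟩
  rw [aux_count, aux_count]
  have hsub : nlv (permWord γ) ⊆ nlv (permWord σ) \ {a} := by
    rw [hγ, hw]
    rintro v ⟨w, hwv, hs⟩
    have hane : a ∉ l₁ ∧ a ∉ x :: l₂ ∧ a ∉ l₃ := by
      simp only [List.nodup_append, List.nodup_cons, List.mem_append] at hnd'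
      refine ⟨fun h => hnd'.2.2 a h a (by simp) rfl, ?_, ?_⟩ <;> tauto
    have hva : v ≠ a := by
      rintro rfl
      simp only [aux_pair_append, aux_pair_cons w v v, List.mem_append] at hs
      have e : ∀ l : List (Fin n), [w, v].Sublist l → v ∈ l := fun l h => h.subset (by simp)
      rcases hs with hs | hs | hs | hs
      · exact hane.1 (e _ hs)
      · exact absurd (hl₁ _ hs.1) (not_le.2 hwv)
      · rcases hs with hs | hs | hs
        · exact hane.2.1 (e _ hs)
        · exact hane.2.2 hs.2
        · exact hane.2.2 (e _ hs)
      · tauto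
    refine ⟨?_, hva⟩
    by_cases hwa : w = a
    · subst hwa
      refine ⟨x, hwv.trans hx, ?_⟩
      have e : ∀ l : List (Fin n), [w, v].Sublist l → w ∈ l := fun l h => h.subset (by simp)
      have e1 := e l₁
      have e2 := e (x :: l₂)
      have e3 := e l₃
      have hvx : v ≠ x := (hwv.trans hx).ne
      simp only [aux_pair_append, aux_pair_cons, List.mem_append, List.mem_cons] at hs e2 hane ⊢
      tauto
    · refine ⟨w, hwv, ?_⟩
      clear hane hnd' hperm hm hmm hl₁ hnd ha' hbm hw
      simp only [aux_pair_append, aux_pair_cons, List.mem_append, List.mem_cons] at hs ⊢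
      tauto
  have h1 := Set.ncard_le_ncard hsub
  have h2 := Set.ncard_sdiff_singleton_add_one ha'
  omega

theorem aux_zero {n : ℕ} (σ : Equiv.Perm (Fin n)) (h : nonLtrMaxCount σ = 0) : σ = 1 := by
  have h' : ∀ i, IsLtrMax σ i := by
    rw [nonLtrMaxCount, Set.ncard_eq_zero] at h
    intro i
    by_contra hi
    exact (Set.eq_empty_iff_forall_notMem.1 h) i hi
  have hm : StrictMono σ := by
    have : Monotone σ := fun i j hij => h' j i hij
    exact this.strictMono_of_injective σ.injective
  ext i
  have := congrArg (fun f : Fin n ≃o Fin n => f i)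
    (Subsingleton.elim (hm.orderIsoOfSurjective σ σ.surjective) (OrderIso.refl _))
  simpa using congrArg Fin.val this

theorem aux_one {n : ℕ} : nonLtrMaxCount (1 : Equiv.Perm (Fin n)) = 0 := by
  rw [nonLtrMaxCount, Set.ncard_eq_zero, Set.eq_empty_iff_forall_notMem]
  intro i hi
  exact hi fun j hj => by simpa using hj

theorem aux_inC (p : ℕ) {n : ℕ} (σ : Equiv.Perm (Fin n)) :
    InC p σ ↔ nonLtrMaxCount σ ≤ p := by
  constructor
  · rintro ⟨q, hq, h⟩
    have := aux_reach q _ _ h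
    rw [aux_one] at this
    omega
  · induction p generalizing σ with
    | zero =>
      intro h
      exact ⟨0, le_rfl, (aux_zero σ (by omega)).symm⟩
    | succ p ih =>
      intro h
      by_cases h0 : nonLtrMaxCount σ = 0
      · exact ⟨0, by omega, (aux_zero σ h0).symm⟩
      · obtain ⟨γ, h1, h2⟩ := aux_back σ h0
        obtain ⟨q, hq, h3⟩ := ih γ (by omega)
        exact ⟨q + 1, by omega, aux_reach_snoc q _ _ _ h3 h1⟩

theorem aux_delete {n : ℕ} (σ : Equiv.Perm (Fin (n + 1))) (j : Fin (n + 1)) :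
    ∃ π : Equiv.Perm (Fin n), ∀ i k, π i < π k ↔ σ (j.succAbove i) < σ (j.succAbove k) := by
  let e : {x // x ≠ j} ≃ {x // x ≠ σ j} := σ.subtypeEquiv (fun a => by simp)
  let π : Equiv.Perm (Fin n) := ((finSuccAboveEquiv j).trans e).trans (finSuccAboveEquiv (σ j)).symm
  have hπ : ∀ i, (σ j).succAbove (π i) = σ (j.succAbove i) := by
    intro i
    have h : finSuccAboveEquiv (σ j) (π i) = e (finSuccAboveEquiv j i) := by simp [π]
    exact congrArg Subtype.val h
  refine ⟨π, fun i k => ?_⟩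
  rw [← hπ, ← hπ, Fin.succAbove_lt_succAbove_iff]

theorem aux_delete_count {n : ℕ} (σ : Equiv.Perm (Fin (n + 1))) (j : Fin (n + 1))
    (π : Equiv.Perm (Fin n))
    (h : ∀ i k, π i < π k ↔ σ (j.succAbove i) < σ (j.succAbove k))
    (hj : ∀ t, t ≠ j → ¬ IsLtrMax σ t → ∃ s, s < t ∧ s ≠ j ∧ σ t < σ s) :
    ({t | ¬ IsLtrMax σ t} \ {j}).ncard ≤ nonLtrMaxCount π := by
  rw [nonLtrMaxCount, ← Set.ncard_image_of_injective _ (Fin.succAbove_right_injective (p := j))]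
  refine Set.ncard_le_ncard ?_ (Set.toFinite _)
  rintro t ⟨ht, htj⟩
  obtain ⟨s, h1, h2, h3⟩ := hj t htj ht
  obtain ⟨t, rfl⟩ := Fin.exists_succAbove_eq htj
  obtain ⟨s, rfl⟩ := Fin.exists_succAbove_eq h2
  refine ⟨t, (aux_not _ _).2 ⟨s, ?_, (h _ _).2 h3⟩, rfl⟩
  simpa using h1

theorem aux_basis (p n : ℕ) (σ : Equiv.Perm (Fin n)) :
    InBasis p σ ↔ nonLtrMaxCount σ = p + 1 ∧
      ∀ j, IsLtrMax σ j → ∃ t, ¬ IsLtrMax σ t ∧ ∀ s, s < t → s ≠ j → σ s < σ t := by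
  simp only [InBasis, aux_inC]
  constructor
  · rintro ⟨h1, h2⟩
    obtain _ | n := n
    · exfalso
      apply h1
      rw [nonLtrMaxCount, Set.eq_empty_of_isEmpty {i | ¬ IsLtrMax σ i}]
      simp
    have h2' : ∀ j, (∀ t, t ≠ j → ¬ IsLtrMax σ t → ∃ s, s < t ∧ s ≠ j ∧ σ t < σ s) →
        ({t | ¬ IsLtrMax σ t} \ {j}).ncard ≤ p := by
      intro j hj
      obtain ⟨π, hπ⟩ := aux_delete σ j
      exact (aux_delete_count σ j π hπ hj).trans
        (h2 n π ⟨j.succAbove, Fin.strictMono_succAbove j, hπ⟩ (by omega))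
    constructor
    · obtain ⟨j, hj⟩ : {t | ¬ IsLtrMax σ t}.Nonempty := by
        apply Set.nonempty_of_ncard_ne_zero
        unfold nonLtrMaxCount at h1
        omega
      have h3 := h2' j (by
        intro t htj ht
        obtain ⟨s, h4, h5⟩ := (aux_not _ _).1 ht
        by_cases hs : s = j
        · subst hs
          obtain ⟨u, h6, h7⟩ := (aux_not _ _).1 hj
          exact ⟨u, h6.trans h4, h6.ne, h5.trans h7⟩
        · exact ⟨s, h4, hs, h5⟩)
      have h4 := Set.ncard_sdiff_singleton_add_one hj
      unfold nonLtrMaxCount at h1 ⊢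
      omega
    · intro j hj
      by_contra hc
      push Not at hc
      have h3 := h2' j (by
        intro t htj ht
        obtain ⟨s, h4, h5, h6⟩ := hc t ht
        exact ⟨s, h4, h5, lt_of_le_of_ne h6 (fun e => h4.ne (σ.injective e).symm)⟩)
      rw [Set.sdiff_singleton_eq_self (by simpa using hj)] at h3
      exact h1 h3
  · rintro ⟨h1, h2⟩
    refine ⟨by omega, ?_⟩
    rintro k π ⟨f, hf, hπ⟩ hk
    have hsub : f '' {i | ¬ IsLtrMax π i} ⊆ {i | ¬ IsLtrMax σ i} := by
      rintro _ ⟨i, hi, rfl⟩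
      obtain ⟨s, h3, h4⟩ := (aux_not _ _).1 hi
      exact (aux_not _ _).2 ⟨f s, hf h3, (hπ _ _).1 h4⟩
    have hex : ∃ t, ¬ IsLtrMax σ t ∧ t ∉ f '' {i | ¬ IsLtrMax π i} := by
      obtain ⟨j, hj⟩ : ∃ j, j ∉ Set.range f := by
        by_contra hc
        push Not at hc
        have := Fintype.card_of_bijective (f := f) ⟨hf.injective, hc⟩
        simp at this
        exact hk this
      by_cases hjl : IsLtrMax σ j
      · obtain ⟨t, ht, h3⟩ := h2 j hjl
        refine ⟨t, ht, ?_⟩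
        rintro ⟨i, hi, rfl⟩
        obtain ⟨s, h4, h5⟩ := (aux_not _ _).1 hi
        have h6 := h3 (f s) (hf h4) (fun e => hj ⟨s, e⟩)
        exact absurd ((hπ _ _).1 h5) h6.not_gt
      · exact ⟨j, hjl, fun ⟨i, _, h⟩ => hj ⟨i, h⟩⟩
    obtain ⟨t, ht, ht'⟩ := hex
    have h3 := Set.ncard_lt_ncard (Set.ssubset_iff_of_subset hsub |>.2 ⟨t, ht, ht'⟩)
    rw [Set.ncard_image_of_injective _ hf.injective] at h3
    unfold nonLtrMaxCount at h1 ⊢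
    omega

theorem aux_prev {n : ℕ} (σ : Equiv.Perm (Fin n)) (j : Fin n) (h0 : 0 < (j : ℕ)) :
    ∃ i, i < j ∧ ∀ s, s < j → σ s ≤ σ i := by
  obtain ⟨i, hi, h⟩ := Finset.exists_max_image (Finset.Iio j) σ
    ⟨⟨0, by omega⟩, by simp [Fin.lt_def, h0]⟩
  exact ⟨i, by simpa using hi, fun s hs => h s (by simpa using hs)⟩

theorem aux_min {n : ℕ} (P : Fin n → Prop) (h : ∃ t, P t) :
    ∃ t, P t ∧ ∀ s, s < t → ¬ P s := by
  obtain ⟨t, ht, hm⟩ := WellFounded.has_min (wellFounded_lt (α := Fin n)) {t | P t} h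
  exact ⟨t, ht, fun s hs hp => hm s hp hs⟩

theorem aux_K {n : ℕ} (σ : Equiv.Perm (Fin n)) (hn : 2 ≤ n) :
    (∀ j, IsLtrMax σ j → ∃ t, ¬ IsLtrMax σ t ∧ ∀ s, s < t → s ≠ j → σ s < σ t) ↔
      (∃ i : Fin n, (σ i : ℕ) = n - 2 ∧ ¬ IsLtrMax σ i) ∧
      (∃ h : 1 < n, ¬ IsLtrMax σ ⟨1, h⟩) ∧
      (∀ i j k : Fin n, i < j → j < k →
        IsLtrMax σ i → IsLtrMax σ j → IsLtrMax σ k →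
        (∀ t : Fin n, i < t → t < k → t ≠ j → ¬ IsLtrMax σ t) →
        ∃ t : Fin n, j < t ∧ t < k ∧ ¬ IsLtrMax σ t ∧ σ i < σ t) := by
  obtain ⟨m, hm⟩ := σ.surjective ⟨n - 1, by omega⟩
  obtain ⟨m', hm'⟩ := σ.surjective ⟨n - 2, by omega⟩
  have hmv : (σ m : ℕ) = n - 1 := by rw [hm]
  have hmv' : (σ m' : ℕ) = n - 2 := by rw [hm']
  have hmax : ∀ s, σ s ≤ σ m := by
    intro s
    rw [Fin.le_def, hmv]
    have := (σ s).isLt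
    omega
  have hmL : IsLtrMax σ m := fun s _ => hmax s
  have hinj : ∀ s t, (σ s : ℕ) = σ t → s = t := fun s t h => σ.injective (Fin.ext h)
  constructor
  · intro K
    have K' : ∀ j, IsLtrMax σ j → ∃ t, ¬ IsLtrMax σ t ∧ j < t ∧ σ t < σ j ∧
        ∀ s, s < t → s ≠ j → σ s < σ t := by
      intro j hj
      obtain ⟨t, h1, h2⟩ := K j hj
      obtain ⟨s, h3, h4⟩ := (aux_not _ _).1 h1
      by_cases hs : s = j
      · subst hs; exact ⟨t, h1, h3, h4, h2⟩
      · exact absurd h4 (h2 s h3 hs).not_gt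
    refine ⟨⟨m', hmv', ?_⟩, ⟨by omega, ?_⟩, ?_⟩
    · intro hL
      obtain ⟨t, h1, h2, h3, h4⟩ := K' m hmL
      have h5 : m' < m := by
        by_contra hc
        have := hL m (not_lt.1 hc)
        rw [Fin.le_def] at this
        omega
      have h6 := h4 m' (h5.trans h2) h5.ne
      rw [Fin.lt_def] at h3 h6
      omega
    · obtain ⟨t, h1, h2, h3, h4⟩ := K' ⟨0, by omega⟩ (by
        intro s hs
        have : s = ⟨0, by omega⟩ := by
          rw [Fin.le_def] at hs
          ext
          simpa using hs
        rw [this])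
      by_cases ht : t = ⟨1, by omega⟩
      · rwa [← ht]
      · rw [aux_not]
        refine ⟨⟨0, by omega⟩, by simp [Fin.lt_def], (h4 _ ?_ ?_).trans h3⟩
        · rw [Fin.lt_def] at h2 ⊢
          have : (t : ℕ) ≠ 1 := fun e => ht (Fin.ext e)
          simp only at h2 ⊢
          omega
        · simp
    · intro i j k hij hjk hi hj hk hbet
      obtain ⟨t, h1, h2, h3, h4⟩ := K' j hj
      refine ⟨t, h2, ?_, h1, h4 i (hij.trans h2) hij.ne⟩
      by_contra hc
      have h5 : k < t := lt_of_le_of_ne (not_lt.1 hc) (by rintro rfl; exact h1 hk)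
      have h6 := h4 k h5 hjk.ne'
      exact absurd (hk j hjk.le) (not_le.2 (h6.trans h3))
  · rintro ⟨⟨i2, hi2, hi2L⟩, ⟨h1n, h1L⟩, h4⟩ j hj
    by_cases hj0 : (j : ℕ) = 0
    · refine ⟨⟨1, h1n⟩, h1L, ?_⟩
      intro s hs hsj
      exfalso
      apply hsj
      ext
      rw [Fin.lt_def] at hs
      simp only at hs
      omega
    · obtain ⟨i, hij, hi⟩ := aux_prev σ j (by omega)
      have hiL : IsLtrMax σ i := fun s hs => hi s (lt_of_le_of_lt hs hij)
      have hb1 : ∀ t, i < t → t < j → ¬ IsLtrMax σ t := fun t h h' =>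
        (aux_not _ _).2 ⟨i, h, lt_of_le_of_ne (hi t h') (fun e => h.ne (σ.injective e).symm)⟩
      have hij' : σ i < σ j := lt_of_le_of_ne (hj i hij.le) (fun e => hij.ne (σ.injective e))
      have hfin : ∀ t, j < t → σ i < σ t → (∀ u, j < u → u ≤ t → ¬ IsLtrMax σ u) →
          ∃ t, ¬ IsLtrMax σ t ∧ ∀ s, s < t → s ≠ j → σ s < σ t := by
        intro t h5 h6 h7
        obtain ⟨u, ⟨hu1, hu2⟩, hu3⟩ := aux_min (fun u => j < u ∧ σ i < σ u) ⟨t, h5, h6⟩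
        have hut : u ≤ t := by
          by_contra hc
          exact hu3 t (not_le.1 hc) ⟨h5, h6⟩
        refine ⟨u, h7 u hu1 hut, ?_⟩
        intro s hs hsj
        refine lt_of_le_of_lt ?_ hu2
        rcases lt_or_gt_of_ne hsj with h | h
        · exact hi s h
        · by_contra hc
          exact hu3 s hs ⟨h, not_le.1 hc⟩
      by_cases hjm : j = m
      · subst hjm
        have e1 : (σ i : ℕ) ≠ n - 2 := by
          intro e
          have : i = i2 := hinj _ _ (e.trans hi2.symm)
          exact hi2L (this ▸ hiL)
        have e2 : σ i < σ i2 := by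
          rw [Fin.lt_def] at hij' ⊢
          omega
        have e3 : j < i2 := by
          rcases lt_trichotomy j i2 with h | h | h
          · exact h
          · subst h; exact absurd hj hi2L
          · exact absurd (hi i2 h) (not_le.2 e2)
        exact hfin i2 e3 e2 fun u hu _ => (aux_not _ _).2
          ⟨j, hu, lt_of_le_of_ne (hmax u) (fun e => hu.ne (σ.injective e).symm)⟩
      · have hjm' : j < m := by
          by_contra hc
          have := hj m (not_lt.1 hc)
          exact hjm (σ.injective (le_antisymm (hmax j) this))
        obtain ⟨k, ⟨hk1, hk2⟩, hk3⟩ := aux_min (fun k => j < k ∧ IsLtrMax σ k) ⟨m, hjm', hmL⟩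
        obtain ⟨t, h5, h6, h7, h8⟩ := h4 i j k hij hk1 hiL hj hk2 (by
          intro t h5 h6 h7
          rcases lt_or_gt_of_ne h7 with h | h
          · exact hb1 t h5 h
          · exact fun hL => hk3 t h6 ⟨h, hL⟩)
        exact hfin t h5 h8 fun u hu hut hL => hk3 u (lt_of_le_of_lt hut h6) ⟨hu, hL⟩

/-- structural characterization of the basis permutations: `σ ∈ Bₚ` iff
(i) `σ` has exactly `p+1` non-left-to-right-maxima; (ii) the (1-based) value `n−1` is a
non-left-to-right-maximum; (iii) `σ₂` is a non-left-to-right-maximum; (iv) between any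
three consecutive left-to-right maxima `σᵢ, σⱼ, σₖ` there is a non-left-to-right-maximum
`σ_t` with `j < t < k` and `σ_t > σᵢ`. (Values are 0-based in `Fin n`, so the 1-based value
`n−1` is `n−2`, and the 1-based position `2` is the index `1`.) -/
theorem inBasis_iff (p n : ℕ) (σ : Equiv.Perm (Fin n)) :
    InBasis p σ ↔
      nonLtrMaxCount σ = p + 1 ∧
      (∃ i : Fin n, (σ i : ℕ) = n - 2 ∧ ¬ IsLtrMax σ i) ∧
      (∃ h : 1 < n, ¬ IsLtrMax σ ⟨1, h⟩) ∧
      (∀ i j k : Fin n, i < j → j < k →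
        IsLtrMax σ i → IsLtrMax σ j → IsLtrMax σ k →
        (∀ t : Fin n, i < t → t < k → t ≠ j → ¬ IsLtrMax σ t) →
        ∃ t : Fin n, j < t ∧ t < k ∧ ¬ IsLtrMax σ t ∧ σ i < σ t) := by
  rw [aux_basis]
  refine and_congr_right fun h => aux_K σ ?_
  by_contra hn
  have : nonLtrMaxCount σ = 0 := by
    rw [nonLtrMaxCount, Set.ncard_eq_zero, Set.eq_empty_iff_forall_notMem]
    intro i hi
    obtain ⟨s, h1, -⟩ := (aux_not _ _).1 hi
    rw [Fin.lt_def] at h1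
    omega
  omega
end

section
/- For all integers n and p with 0 ≤ p < n−2, the numbers b_{n,p} satisfy the recurrence b_{n,p} = Σ_{ℓ=0}^{p−1} (ℓ+1)! · C(n−2, ℓ) · b_{n−ℓ−2, p−ℓ−1}, anchored with b_{n,p} = 0 whenever 2p < n−2 or p > n−2, and b_{n,n−2} = (n−1)! for n > 1. -/
set_option linter.unusedSectionVars false

def NLx {α : Type*} [LinearOrder α] (l : List α) (x : α) : Prop :=
  ∃ y, x < y ∧ [y, x].Sublist l

open Classical in
noncomputable def nls {α : Type*} [LinearOrder α] (l : List α) : Finset α :=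
  l.toFinset.filter (NLx l)

noncomputable def nlc {α : Type*} [LinearOrder α] (l : List α) : ℕ := (nls l).card

def Good {α : Type*} [LinearOrder α] (l : List α) : Prop :=
  ∀ a ∈ l, ¬ NLx l a → ∃ x, x < a ∧ [a, x].Sublist l ∧
    ∀ y, [y, x].Sublist l → x < y → y = a

section
variable {α : Type*} [LinearOrder α]

theorem pair_cons (y x a : α) (v : List α) :
    [y, x].Sublist (a :: v) ↔ [y, x].Sublist v ∨ (y = a ∧ x ∈ v) := by
  rw [List.sublist_cons_iff]
  constructor
  · rintro (h | ⟨r, h, h'⟩)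
    · exact Or.inl h
    · simp at h
      obtain ⟨rfl, rfl⟩ := h
      exact Or.inr ⟨rfl, by simpa using h'⟩
  · rintro (h | ⟨rfl, h⟩)
    · exact Or.inl h
    · exact Or.inr ⟨[x], rfl, by simpa using h⟩

theorem pair_append (y x : α) (u v : List α) :
    [y, x].Sublist (u ++ v) ↔ [y, x].Sublist u ∨ [y, x].Sublist v ∨ (y ∈ u ∧ x ∈ v) := by
  induction u with
  | nil => simp
  | cons a u ih =>
    rw [List.cons_append, pair_cons, pair_cons, ih]
    simp only [List.mem_append, List.mem_cons]
    tauto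

theorem pair_mem {y x : α} {l : List α} (h : [y, x].Sublist l) : y ∈ l ∧ x ∈ l :=
  ⟨h.subset (by simp), h.subset (by simp)⟩

theorem mem_nls {l : List α} {x : α} : x ∈ nls l ↔ NLx l x := by
  unfold nls
  simp only [Finset.mem_filter, List.mem_toFinset, and_iff_right_iff_imp]
  rintro ⟨y, -, h⟩
  exact (pair_mem h).2

theorem pair_trans {l : List α} (hl : l.Nodup) {a b c : α} (h1 : [a, b].Sublist l)
    (h2 : [b, c].Sublist l) : [a, c].Sublist l := by
  obtain ⟨u, v, rfl⟩ := List.append_of_mem (pair_mem h1).2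
  simp only [List.nodup_append, List.nodup_cons, List.mem_cons] at hl
  rw [pair_append, pair_cons] at *
  have := @pair_mem α _
  grind

theorem NLx_mono {l l' : List α} (h : l'.Sublist l) {x : α} (hx : NLx l' x) : NLx l x := by
  obtain ⟨y, h1, h2⟩ := hx
  exact ⟨y, h1, h2.trans h⟩

theorem pair_filter {l : List α} {a y x : α} (h : [y, x].Sublist l) (hy : y ≠ a) (hx : x ≠ a) :
    [y, x].Sublist (l.filter (fun z => decide (z ≠ a))) := by
  have := h.filter (fun z => decide (z ≠ a))
  simpa [List.filter_cons, hy, hx] using this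

theorem basis_list {l : List α} (hl : l.Nodup) (p : ℕ) :
    (p < nlc l ∧ ∀ l' : List α, l'.Sublist l → l' ≠ l → nlc l' ≤ p) ↔
      nlc l = p + 1 ∧ Good l := by
  constructor
  · rintro ⟨h1, h2⟩
    have h3 : ∀ a ∈ l, nlc (l.filter (fun z => decide (z ≠ a))) ≤ p := by
      intro a ha
      apply h2 _ List.filter_sublist
      intro h
      rw [← h] at ha
      simp at ha
    constructor
    · have : (nls l).Nonempty := by
        rw [← Finset.card_pos]; unfold nlc at h1; omega
      obtain ⟨a, ha⟩ := this
      rw [mem_nls] at ha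
      obtain ⟨b, hb, hba⟩ := ha
      have h4 := h3 a (pair_mem hba).2
      have h5 : nls l ⊆ insert a (nls (l.filter (fun z => decide (z ≠ a)))) := by
        intro x hx
        rw [Finset.mem_insert]
        by_cases hxa : x = a
        · exact Or.inl hxa
        right
        rw [mem_nls] at *
        obtain ⟨y, hy, hyx⟩ := hx
        by_cases hya : y = a
        · subst hya
          exact ⟨b, hy.trans hb, pair_filter (pair_trans hl hba hyx) hb.ne' hxa⟩
        · exact ⟨y, hy, pair_filter hyx hya hxa⟩
      have := Finset.card_le_card h5
      have := Finset.card_insert_le a (nls (l.filter (fun z => decide (z ≠ a))))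
      unfold nlc at *
      omega
    · intro a ha hna
      by_contra hcon
      push Not at hcon
      have h4 := h3 a ha
      have h5 : nls l ⊆ nls (l.filter (fun z => decide (z ≠ a))) := by
        intro x hx
        rw [mem_nls] at *
        have hxa : x ≠ a := by rintro rfl; exact hna hx
        obtain ⟨y, hy, hyx⟩ := hx
        by_cases hya : y = a
        · subst hya
          obtain ⟨z, hz, hz2, hz3⟩ := hcon x hy hyx
          exact ⟨z, hz2, pair_filter hz hz3 hxa⟩
        · exact ⟨y, hy, pair_filter hyx hya hxa⟩
      have := Finset.card_le_card h5
      unfold nlc at *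
      omega
  · rintro ⟨h1, h2⟩
    refine ⟨by omega, fun l' hs hne => ?_⟩
    have : ∃ a ∈ l, a ∉ l' := by
      by_contra hcon
      push Not at hcon
      apply hne
      apply hs.eq_of_length_le
      exact (List.subperm_of_subset hl hcon).length_le
    obtain ⟨a, ha, ha'⟩ := this
    have key : ∃ x, NLx l x ∧ ¬ NLx l' x := by
      by_cases hna : NLx l a
      · refine ⟨a, hna, ?_⟩
        rintro ⟨y, _, hy⟩
        exact ha' (pair_mem hy).2
      · obtain ⟨x, hx, hx2, hx3⟩ := h2 a ha hna
        refine ⟨x, ⟨a, hx, hx2⟩, ?_⟩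
        rintro ⟨y, hy1, hy2⟩
        have := hx3 y (hy2.trans hs) hy1
        subst this
        exact ha' (pair_mem hy2).1
    obtain ⟨x, hx, hx'⟩ := key
    have h5 : nls l' ⊂ nls l := by
      rw [Finset.ssubset_iff_of_subset]
      · exact ⟨x, mem_nls.2 hx, fun h => hx' (mem_nls.1 h)⟩
      · intro z hz
        rw [mem_nls] at *
        exact NLx_mono hs hz
    have := Finset.card_lt_card h5
    unfold nlc at *
    omega

theorem nlc_jump (l₁ l₂ l₃ : List α) (a : α) :
    nlc (l₁ ++ (l₂ ++ a :: l₃)) ≤ nlc (l₁ ++ a :: (l₂ ++ l₃)) + 1 := by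
  have h5 : nls (l₁ ++ (l₂ ++ a :: l₃)) ⊆ insert a (nls (l₁ ++ a :: (l₂ ++ l₃))) := by
    intro x hx
    rw [Finset.mem_insert]
    by_cases hxa : x = a
    · exact Or.inl hxa
    right
    rw [mem_nls] at *
    obtain ⟨y, hy, h⟩ := hx
    refine ⟨y, hy, ?_⟩
    simp only [pair_append, pair_cons, List.mem_append, List.mem_cons] at *
    tauto
  exact (Finset.card_le_card h5).trans (Finset.card_insert_le _ _)

theorem pair_back (l₁ l₂ l₃ : List α) (a y x : α) (h : [y, x].Sublist (l₁ ++ a :: (l₂ ++ l₃))) :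
    [y, x].Sublist (l₁ ++ (l₂ ++ a :: l₃)) ∨ (y = a ∧ x ∈ l₂) := by
  simp only [pair_append, pair_cons, List.mem_append, List.mem_cons] at *
  tauto

theorem exists_back {l : List α} (hl : l.Nodup) (h : 0 < nlc l) :
    ∃ (l₁ l₂ l₃ : List α) (a : α), l₂ ≠ [] ∧ l = l₁ ++ (l₂ ++ a :: l₃) ∧
      nlc (l₁ ++ a :: (l₂ ++ l₃)) < nlc l := by
  obtain ⟨a, ha⟩ := Finset.card_pos.1 h
  rw [mem_nls] at ha
  obtain ⟨b, hb, hba⟩ := ha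
  obtain ⟨u, v, rfl⟩ := List.append_of_mem (pair_mem hba).2
  have hbu : b ∈ u := by
    simp only [List.nodup_append, List.nodup_cons, List.mem_cons] at hl
    rw [pair_append, pair_cons] at hba
    have := @pair_mem α _
    grind
  have h1 := List.takeWhile_append_dropWhile (p := fun z => decide (z ≤ a)) (l := u)
  have h2 : ∀ z ∈ u.takeWhile (fun z => decide (z ≤ a)), z ≤ a := by
    intro z hz
    simpa using List.mem_takeWhile_imp hz
  have h3 : u.dropWhile (fun z => decide (z ≤ a)) ≠ [] := by
    intro h
    rw [List.dropWhile_eq_nil_iff] at h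
    have := h b hbu
    simp at this
    exact absurd hb (not_lt.2 this)
  have h4 := List.head_dropWhile_not (fun z => decide (z ≤ a)) h3
  generalize u.takeWhile (fun z => decide (z ≤ a)) = l₁ at *
  generalize hd : u.dropWhile (fun z => decide (z ≤ a)) = l₂ at *
  cases l₂ with
  | nil => exact absurd rfl h3
  | cons c l₂ =>
  replace h4 : a < c := not_le.1 (of_decide_eq_false h4)
  subst h1
  refine ⟨l₁, c :: l₂, v, a, by simp, by simp, ?_⟩
  apply Finset.card_lt_card
  rw [Finset.ssubset_iff_of_subset]
  · refine ⟨a, mem_nls.2 ⟨c, h4, ?_⟩, ?_⟩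
    · simp [pair_append, pair_cons]
    · rw [mem_nls]
      rintro ⟨y, hy, hs⟩
      simp only [List.nodup_append, List.nodup_cons, List.mem_cons, List.mem_append] at hl
      simp only [pair_append, pair_cons, List.mem_append, List.mem_cons] at hs
      have := @pair_mem α _
      grind
  · intro x hx
    rw [mem_nls] at *
    obtain ⟨y, hy, hs⟩ := hx
    have hc := pair_back l₁ (c :: l₂) v a y x hs
    rw [← List.append_assoc] at hc
    rcases hc with hc | ⟨rfl, hc⟩
    · exact ⟨y, hy, hc⟩
    · rw [List.mem_cons] at hc
      rcases hc with rfl | hc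
      · exact absurd hy (not_lt.2 h4.le)
      · refine ⟨c, hy.trans h4, ?_⟩
        simp only [pair_append, pair_cons]
        tauto
end

section
variable {n : ℕ}

theorem permWord_nodup (σ : Equiv.Perm (Fin n)) : (permWord σ).Nodup :=
  List.nodup_ofFn.2 σ.injective

theorem permWord_length (σ : Equiv.Perm (Fin n)) : (permWord σ).length = n := by
  simp [permWord]

theorem permWord_inj {σ τ : Equiv.Perm (Fin n)} (h : permWord σ = permWord τ) : σ = τ := by
  have := List.ofFn_injective h
  ext i
  exact congrArg Fin.val (congrFun this i)

theorem exists_permWord {l : List (Fin n)} (h : l.Nodup) (hl : l.length = n) :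
    ∃ σ : Equiv.Perm (Fin n), permWord σ = l := by
  refine ⟨Equiv.ofBijective (fun i => l.get (i.cast hl.symm)) (Finite.injective_iff_bijective.1 ?_), ?_⟩
  · intro i j hij
    have := List.nodup_iff_injective_get.1 h hij
    simpa using this
  · apply List.ext_getElem
    · simp [permWord, hl]
    · intro i h1 h2
      simp [permWord]

theorem eq_one_of_nlc {σ : Equiv.Perm (Fin n)} (h : nlc (permWord σ) = 0) : σ = 1 := by
  have h1 : (permWord σ).Pairwise (· ≤ ·) := by
    rw [List.pairwise_iff_forall_sublist]
    intro a b hab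
    by_contra hlt
    push Not at hlt
    have : b ∈ nls (permWord σ) := mem_nls.2 ⟨a, hlt, hab⟩
    rw [Finset.card_eq_zero.1 h] at this
    simp at this
  rw [permWord, List.pairwise_ofFn] at h1
  have h2 : StrictMono σ := fun i j hij => lt_of_le_of_ne (h1 hij) (fun h => hij.ne (σ.injective h))
  have : (h2.orderIsoOfSurjective σ σ.surjective) = OrderIso.refl _ := Subsingleton.elim _ _
  ext i
  have := congrArg (fun f => f i) this
  simp at this
  simp [this]

theorem nlc_one : nlc (permWord (1 : Equiv.Perm (Fin n))) = 0 := by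
  rw [nlc, Finset.card_eq_zero, Finset.eq_empty_iff_forall_notMem]
  intro x hx
  rw [mem_nls] at hx
  obtain ⟨y, hy, hs⟩ := hx
  have : (permWord (1 : Equiv.Perm (Fin n))).Pairwise (· ≤ ·) := by
    rw [permWord, List.pairwise_ofFn]
    intro i j h
    exact h.le
  exact absurd hy (not_lt.2 (List.pairwise_iff_forall_sublist.1 this hs))

theorem reach_snoc {p : ℕ} {α β γ : Equiv.Perm (Fin n)} (h : ReachIn p α β) (h' : RightJump β γ) :
    ReachIn (p + 1) α γ := by
  induction p generalizing α with
  | zero => 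
    cases h
    exact ⟨γ, h', rfl⟩
  | succ p ih =>
    obtain ⟨δ, h1, h2⟩ := h
    exact ⟨δ, h1, ih h2⟩

theorem reach_le {p : ℕ} {α β : Equiv.Perm (Fin n)} (h : ReachIn p α β) :
    nlc (permWord β) ≤ nlc (permWord α) + p := by
  induction p generalizing α with
  | zero => 
    cases h
    simp
  | succ p ih =>
    obtain ⟨δ, ⟨l₁, l₂, l₃, a, _, h1, h2⟩, h3⟩ := h
    have := ih h3
    have := nlc_jump l₁ l₂ l₃ a
    rw [← h1, ← h2] at this
    omega

theorem inC_of_le : ∀ (p : ℕ) (σ : Equiv.Perm (Fin n)), nlc (permWord σ) ≤ p → InC p σ := by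
  intro p
  induction p with
  | zero =>
    intro σ h
    have := eq_one_of_nlc (Nat.le_zero.1 h)
    exact ⟨0, le_rfl, this.symm⟩
  | succ p ih =>
    intro σ h
    by_cases h0 : nlc (permWord σ) = 0
    · have := eq_one_of_nlc h0
      exact ⟨0, by omega, this.symm⟩
    obtain ⟨l₁, l₂, l₃, a, h1, h2, h3⟩ := exists_back (permWord_nodup σ) (Nat.pos_of_ne_zero h0)
    have hp : (l₁ ++ a :: (l₂ ++ l₃)).Perm (permWord σ) := by
      rw [h2]
      exact List.Perm.append_left _ List.perm_middle.symm
    obtain ⟨γ, hγ⟩ := exists_permWord (hp.nodup_iff.2 (permWord_nodup σ))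
      (hp.length_eq.trans (permWord_length σ))
    obtain ⟨q, hq, hr⟩ := ih γ (by rw [hγ]; omega)
    exact ⟨q + 1, by omega, reach_snoc hr ⟨l₁, l₂, l₃, a, h1, hγ, h2⟩⟩

theorem inC_iff (p : ℕ) (σ : Equiv.Perm (Fin n)) : InC p σ ↔ nlc (permWord σ) ≤ p := by
  refine ⟨?_, inC_of_le p σ⟩
  rintro ⟨q, hq, h⟩
  have := reach_le h
  rw [nlc_one] at this
  omega
end

section
variable {α β : Type*} [LinearOrder α] [LinearOrder β]

theorem pair_map (φ : β → α) (y x : α) (l : List β) :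
    [y, x].Sublist (l.map φ) ↔ ∃ y' x', φ y' = y ∧ φ x' = x ∧ [y', x'].Sublist l := by
  rw [List.sublist_map_iff]
  constructor
  · rintro ⟨l', h, h'⟩
    match l', h' with
    | [a, b], h' =>
      simp at h'
      exact ⟨a, b, h'.1.symm, h'.2.symm, h⟩
  · rintro ⟨a, b, rfl, rfl, h⟩
    exact ⟨[a, b], h, rfl⟩

theorem pair_map' {φ : β → α} (hφ : StrictMono φ) (y x : β) (l : List β) :
    [φ y, φ x].Sublist (l.map φ) ↔ [y, x].Sublist l := by
  rw [pair_map]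
  constructor
  · rintro ⟨a, b, h1, h2, h⟩
    rwa [← hφ.injective h1, ← hφ.injective h2]
  · intro h
    exact ⟨y, x, rfl, rfl, h⟩

theorem NLx_map {φ : β → α} (hφ : StrictMono φ) (x : β) (l : List β) :
    NLx (l.map φ) (φ x) ↔ NLx l x := by
  constructor
  · rintro ⟨y, hy, h⟩
    obtain ⟨y', x', rfl, h2, h3⟩ := (pair_map _ _ _ _).1 h
    rw [hφ.injective h2] at h3
    exact ⟨y', hφ.lt_iff_lt.1 hy, h3⟩
  · rintro ⟨y, hy, h⟩
    exact ⟨φ y, hφ hy, (pair_map' hφ _ _ _).2 h⟩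

theorem nlc_map {φ : β → α} (hφ : StrictMono φ) (l : List β) : nlc (l.map φ) = nlc l := by
  symm
  refine Finset.card_bij (fun x _ => φ x) ?_ (fun _ _ _ _ h => hφ.injective h) ?_
  · intro x hx
    rw [mem_nls] at *
    exact (NLx_map hφ _ _).2 hx
  · intro z hz
    rw [mem_nls] at hz
    have : z ∈ l.map φ := by
      obtain ⟨y, _, h⟩ := hz
      exact (pair_mem h).2
    obtain ⟨x, _, rfl⟩ := List.mem_map.1 this
    exact ⟨x, mem_nls.2 ((NLx_map hφ _ _).1 hz), rfl⟩

theorem good_map {φ : β → α} (hφ : StrictMono φ) (l : List β) : Good (l.map φ) ↔ Good l := by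
  constructor
  · intro h a ha hna
    obtain ⟨z, hz, h1, h2⟩ := h (φ a) (List.mem_map_of_mem ha) (by rwa [NLx_map hφ])
    obtain ⟨x, _, rfl⟩ := List.mem_map.1 (pair_mem h1).2
    refine ⟨x, hφ.lt_iff_lt.1 hz, (pair_map' hφ _ _ _).1 h1, fun y hy hxy => ?_⟩
    exact hφ.injective (h2 (φ y) ((pair_map' hφ _ _ _).2 hy) (hφ hxy))
  · intro h a ha hna
    obtain ⟨a, ha', rfl⟩ := List.mem_map.1 ha
    rw [NLx_map hφ] at hna
    obtain ⟨x, hx, h1, h2⟩ := h a ha' hna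
    refine ⟨φ x, hφ hx, (pair_map' hφ _ _ _).2 h1, fun y hy hxy => ?_⟩
    obtain ⟨y, _, rfl⟩ := List.mem_map.1 (pair_mem hy).1
    rw [h2 y ((pair_map' hφ _ _ _).1 hy) (hφ.lt_iff_lt.1 hxy)]

theorem exists_std {V : Finset α} {k : ℕ} (hk : V.card = k) {l : List α} (hl : ∀ x ∈ l, x ∈ V) :
    ∃ l' : List (Fin k), l'.map (V.orderEmbOfFin hk) = l := by
  have : l ∈ Set.range (List.map (V.orderEmbOfFin hk)) := by
    rw [Set.range_list_map]
    intro x hx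
    rw [Finset.range_orderEmbOfFin]
    exact hl x hx
  exact this
end

theorem inBasis_iff_s8 {n : ℕ} (p : ℕ) (σ : Equiv.Perm (Fin n)) :
    InBasis p σ ↔ nlc (permWord σ) = p + 1 ∧ Good (permWord σ) := by
  rw [← basis_list (permWord_nodup σ), InBasis, inC_iff, not_le]
  refine and_congr_right fun _ => ?_
  constructor
  · intro h l' hs hne
    have hnd := (permWord_nodup σ).sublist hs
    have hc := List.toFinset_card_of_nodup hnd
    obtain ⟨l'', hl''⟩ := exists_std hc (l := l') (by simp)
    have hmono := (l'.toFinset.orderEmbOfFin hc).strictMono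
    obtain ⟨π, hπ⟩ := exists_permWord (l := l'') (by
      rw [← hl''] at hnd; exact hnd.of_map _) (by rw [← List.length_map (l'.toFinset.orderEmbOfFin hc), hl''])
    have hnlc := nlc_map hmono l''
    rw [hl'', ← hπ] at hnlc
    rw [hnlc, ← inC_iff]
    apply h
    · obtain ⟨f, hf⟩ := List.sublist_iff_exists_fin_orderEmbedding_get_eq.1 hs
      have hlen := permWord_length σ
      refine ⟨fun i => (f i).cast hlen, ?_, ?_⟩
      · intro i j hij
        simpa using hij
      · have key : ∀ i, σ ((f i).cast hlen) = l'.toFinset.orderEmbOfFin hc (π i) := by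
          intro i
          have h1 := hf i
          have h2 : l'.get i = l'.toFinset.orderEmbOfFin hc (π i) := by
            have : l'[i.1]? = some (l'.toFinset.orderEmbOfFin hc (π i)) := by
              have h4 := congrArg (fun L : List (Fin n) => L[i.1]?) hl''
              rw [← h4, ← hπ]
              simp [permWord]
            rw [List.getElem?_eq_getElem i.2] at this
            simpa using this
          rw [h2] at h1
          rw [h1]
          simp [permWord]
          rfl
        intro i j
        rw [key, key]
        simp
    · intro hk
      apply hne
      exact hs.eq_of_length (by rw [hk, permWord_length])
  · rintro h k π ⟨f, hf, hπ⟩ hkn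
    rw [inC_iff]
    have hφ : StrictMono (fun v => σ (f (π.symm v))) := by
      intro a b hab
      rw [← hπ]
      simpa using hab
    rw [← nlc_map hφ]
    have he : (permWord π).map (fun v => σ (f (π.symm v))) = List.ofFn (fun i => σ (f i)) := by
      simp [permWord, List.map_ofFn, Function.comp_def]
    rw [he]
    apply h
    · rw [List.sublist_iff_exists_fin_orderEmbedding_get_eq]
      have h1 : (List.ofFn (fun i => σ (f i))).length = k := by simp
      have h2 := permWord_length σ
      refine ⟨OrderEmbedding.ofStrictMono (fun i => (f (i.cast h1)).cast h2.symm) ?_, ?_⟩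
      · intro i j hij
        have : i.cast h1 < j.cast h1 := hij
        exact hf this
      · intro i
        simp [permWord]
        rfl
    · intro he
      apply hkn
      have := congrArg List.length he
      simpa [permWord_length] using this

section
variable {α β : Type*} [LinearOrder α] [LinearOrder β]

noncomputable def Wd (V : Finset α) : Finset (List α) := V.toList.permutations.toFinset

theorem mem_Wd {V : Finset α} {l : List α} : l ∈ Wd V ↔ l.Nodup ∧ ∀ x, x ∈ l ↔ x ∈ V := by
  unfold Wd
  rw [List.mem_toFinset, List.mem_permutations]
  constructor
  · intro h
    refine ⟨h.nodup_iff.2 V.nodup_toList, fun x => ?_⟩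
    rw [h.mem_iff, Finset.mem_toList]
  · rintro ⟨h1, h2⟩
    rw [List.perm_ext_iff_of_nodup h1 V.nodup_toList]
    simpa using h2

theorem card_Wd (V : Finset α) : (Wd V).card = V.card.factorial := by
  unfold Wd
  rw [List.toFinset_card_of_nodup (List.nodup_permutations _ V.nodup_toList),
    List.length_permutations, Finset.length_toList]

theorem Wd_toFinset {V : Finset α} {l : List α} (h : l ∈ Wd V) : l.toFinset = V := by
  ext x
  rw [List.mem_toFinset, (mem_Wd.1 h).2]

theorem Wd_length {V : Finset α} {l : List α} (h : l ∈ Wd V) : l.length = V.card := by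
  rw [← Wd_toFinset h, List.toFinset_card_of_nodup (mem_Wd.1 h).1]

open Classical in
noncomputable def Gs (V : Finset α) (k q : ℕ) : Finset (List α) :=
  (Wd V).filter (fun l => nlc l + k = q ∧ Good l)

theorem mem_Gs {V : Finset α} {k q : ℕ} {l : List α} :
    l ∈ Gs V k q ↔ l ∈ Wd V ∧ nlc l + k = q ∧ Good l := by
  simp [Gs]

theorem Gs_std (V : Finset α) (k q : ℕ) :
    (Gs V k q).card = (Gs (Finset.univ : Finset (Fin V.card)) k q).card := by
  symm
  have hmono := (V.orderEmbOfFin rfl).strictMono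
  refine Finset.card_bij (fun l _ => l.map (V.orderEmbOfFin rfl)) ?_ ?_ ?_
  · intro l hl
    rw [mem_Gs, mem_Wd] at *
    rw [nlc_map hmono, good_map hmono]
    refine ⟨⟨hl.1.1.map hmono.injective, fun x => ?_⟩, hl.2⟩
    rw [← Finset.mem_coe, ← Finset.range_orderEmbOfFin V rfl, List.mem_map, Set.mem_range]
    simp only [hl.1.2, Finset.mem_univ, true_and]
  · intro l _ l' _ h
    exact List.map_injective_iff.2 hmono.injective h
  · intro l hl
    rw [mem_Gs, mem_Wd] at hl
    obtain ⟨l', rfl⟩ := exists_std (V := V) rfl (l := l) (fun x hx => (hl.1.2 x).1 hx)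
    rw [nlc_map hmono, good_map hmono] at hl
    refine ⟨l', ?_, rfl⟩
    rw [mem_Gs, mem_Wd]
    refine ⟨⟨hl.1.1.of_map _, fun x => ?_⟩, hl.2⟩
    have := (hl.1.2 (V.orderEmbOfFin rfl x)).2 (Finset.orderEmbOfFin_mem _ _ _)
    rw [List.mem_map] at this
    obtain ⟨a, ha, h⟩ := this
    rw [hmono.injective h] at ha
    simpa using ha

theorem nls_subset (l : List α) : nls l ⊆ l.toFinset := by
  intro x hx
  obtain ⟨y, _, h⟩ := mem_nls.1 hx
  exact List.mem_toFinset.2 (pair_mem h).2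

theorem nlc_lt {l : List α} (hl : l.Nodup) (h : l ≠ []) : nlc l < l.length := by
  rw [← List.toFinset_card_of_nodup hl]
  apply Finset.card_lt_card
  rw [Finset.ssubset_iff_of_subset (nls_subset l)]
  cases l with
  | nil => exact absurd rfl h
  | cons a l =>
    refine ⟨a, by simp, ?_⟩
    rw [mem_nls]
    rintro ⟨y, hy, hs⟩
    rw [pair_cons] at hs
    rw [List.nodup_cons] at hl
    rcases hs with hs | hs
    · exact hl.1 (pair_mem hs).2
    · exact hl.1 hs.2

theorem good_le {l : List α} (hl : l.Nodup) (h : Good l) : l.length ≤ 2 * nlc l := by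
  rw [← List.toFinset_card_of_nodup hl]
  have h1 := Finset.card_sdiff_add_card_eq_card (nls_subset l)
  have h2 : (l.toFinset \ nls l).card ≤ (nls l).card := by
    have : ∀ a : α, ∃ x, a ∈ l.toFinset \ nls l → x < a ∧ [a, x].Sublist l ∧
        ∀ y, [y, x].Sublist l → x < y → y = a := by
      intro a
      by_cases ha : a ∈ l.toFinset \ nls l
      · have ha' := ha
        rw [Finset.mem_sdiff, mem_nls, List.mem_toFinset] at ha'
        obtain ⟨x, hx⟩ := h a ha'.1 ha'.2
        exact ⟨x, fun _ => hx⟩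
      · exact ⟨a, fun h => absurd h ha⟩
    choose w hw using this
    apply Finset.card_le_card_of_injOn w
    · intro a ha
      obtain ⟨h1, h2, h3⟩ := hw a ha
      exact mem_nls.2 ⟨a, h1, h2⟩
    · intro a ha b hb hab
      obtain ⟨h1, h2, h3⟩ := hw a ha
      obtain ⟨h1', h2', h3'⟩ := hw b hb
      rw [← hab] at h1' h2'
      exact (h3 b h2' h1').symm
  unfold nlc
  omega

theorem nlc_split {pre suf : List α} {M : α} (hn : (pre ++ M :: suf).Nodup)
    (hM : ∀ x ∈ pre ++ suf, x < M) : nlc (pre ++ M :: suf) = nlc pre + suf.length := by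
  have hm := @pair_mem α _
  have hd : Disjoint (nls pre) suf.toFinset := by
    rw [Finset.disjoint_left]
    intro a ha ha'
    have := List.mem_toFinset.1 (nls_subset _ ha)
    rw [List.mem_toFinset] at ha'
    simp only [List.nodup_append, List.mem_cons] at hn
    exact hn.2.2 a this a (Or.inr ha') rfl
  have hs : suf.Nodup := (List.nodup_cons.1 (List.nodup_append.1 hn).2.1).2
  rw [← List.toFinset_card_of_nodup hs, nlc, nlc, ← Finset.card_union_of_disjoint hd]
  congr 1
  ext x
  rw [Finset.mem_union, mem_nls, mem_nls, List.mem_toFinset]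
  constructor
  · rintro ⟨y, hy, h⟩
    have hx := (pair_mem h).2
    have hyl := (pair_mem h).1
    rw [List.mem_append, List.mem_cons] at hx hyl
    rcases hx with hx | rfl | hx
    · left
      refine ⟨y, hy, ?_⟩
      simp only [List.nodup_append, List.nodup_cons, List.mem_cons] at hn
      rw [pair_append, pair_cons] at h
      grind
    · exfalso
      simp only [List.mem_append] at hM
      grind
    · exact Or.inr hx
  · rintro (h | h)
    · exact NLx_mono (List.sublist_append_left _ _) h
    · refine ⟨M, hM x (by simp [h]), ?_⟩
      simp [pair_append, pair_cons, h]

theorem good_split {pre suf : List α} {M M' : α} (hn : (pre ++ M :: suf).Nodup)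
    (hM : ∀ x ∈ pre ++ suf, x < M) (hM1 : M' ∈ pre ++ suf) (hM2 : ∀ x ∈ pre ++ suf, x ≤ M') :
    Good (pre ++ M :: suf) ↔ Good pre ∧ M' ∈ suf := by
  have hm := @pair_mem α _
  have hpair : ∀ y x, x ∈ pre → ([y, x].Sublist (pre ++ M :: suf) ↔ [y, x].Sublist pre) := by
    intro y x hx
    simp only [List.nodup_append, List.nodup_cons, List.mem_cons] at hn
    rw [pair_append, pair_cons]
    grind
  have hNL : ∀ x ∈ pre, (NLx (pre ++ M :: suf) x ↔ NLx pre x) := by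
    intro x hx
    simp only [NLx, hpair _ x hx]
  have hNLM : ¬ NLx (pre ++ M :: suf) M := by
    rintro ⟨y, hy, h⟩
    have hyl := (pair_mem h).1
    simp only [List.mem_append, List.mem_cons] at hM hyl
    grind
  have hpM : ∀ x ∈ suf, [M, x].Sublist (pre ++ M :: suf) := by
    intro x h
    simp [pair_append, pair_cons, h]
  constructor
  · intro h
    constructor
    · intro a ha hna
      obtain ⟨x, hx, h1, h2⟩ := h a (by simp [ha]) (by rwa [hNL a ha])
      have haM : a < M := hM a (by simp [ha])
      have hxp : x ∈ pre := by
        have := (pair_mem h1).2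
        rw [List.mem_append, List.mem_cons] at this
        rcases this with h3 | rfl | h3
        · exact h3
        · exact absurd hx haM.asymm
        · have := h2 M (hpM x h3) (hx.trans haM)
          exact absurd this haM.ne'
      refine ⟨x, hx, (hpair _ _ hxp).1 h1, fun y hy => h2 y ((hpair _ _ hxp).2 hy)⟩
    · obtain ⟨x, hx, h1, h2⟩ := h M (by simp) hNLM
      have hxs : x ∈ suf := by
        simp only [List.nodup_append, List.nodup_cons, List.mem_cons] at hn
        rw [pair_append, pair_cons] at h1
        grind
      rw [List.mem_append] at hM1
      rcases hM1 with h3 | h3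
      · exfalso
        have hp : [M', x].Sublist (pre ++ M :: suf) := by
          simp [pair_append, h3, hxs]
        have hne : M' ≠ x := by
          rintro rfl
          simp only [List.nodup_append, List.mem_cons] at hn
          exact hn.2.2 M' h3 M' (Or.inr hxs) rfl
        have hle := hM2 x (by simp [hxs])
        have := h2 M' hp (lt_of_le_of_ne hle hne.symm)
        exact absurd this (hM M' (by simp [h3])).ne
      · exact h3
  · rintro ⟨h, hs⟩ a ha hna
    rw [List.mem_append, List.mem_cons] at ha
    rcases ha with ha | rfl | ha
    · obtain ⟨x, hx, h1, h2⟩ := h a ha (by rwa [← hNL a ha])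
      have hxp := (pair_mem h1).2
      exact ⟨x, hx, (hpair _ _ hxp).2 h1, fun y hy => h2 y ((hpair _ _ hxp).1 hy)⟩
    · refine ⟨M', hM M' hM1, hpM _ hs, fun y hy hlt => ?_⟩
      have := (pair_mem hy).1
      simp only [List.mem_append, List.mem_cons] at this hM2
      grind
    · exact absurd ⟨M, hM a (by simp [ha]), hpM a ha⟩ hna

theorem Gs_rec {U V : Finset α} {M M' : α} (hMM : M' < M) (hU : ∀ x ∈ U, x < M')
    (hV : V = insert M (insert M' U)) (q : ℕ) :
    (Gs V 0 q).card = ∑ S ∈ U.powerset,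
      (Gs (U \ S) (S.card + 1) q).card * (S.card + 1).factorial := by
  have hM'U : M' ∉ U := fun h => lt_irrefl _ (hU _ h)
  have hMU : M ∉ U := fun h => lt_asymm hMM (hU _ h)
  have hlist : ∀ S ∈ U.powerset, ∀ pre ∈ Wd (U \ S), ∀ suf ∈ Wd (insert M' S),
      pre ++ M :: suf ∈ Wd V ∧ (nlc (pre ++ M :: suf) = nlc pre + (S.card + 1)) ∧
      (Good (pre ++ M :: suf) ↔ Good pre) := by
    intro S hS pre hpre suf hsuf
    rw [Finset.mem_powerset] at hS
    have hlen := Wd_length hsuf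
    rw [Finset.card_insert_of_notMem (fun h => hM'U (hS h))] at hlen
    rw [mem_Wd] at hpre hsuf
    have hnd : (pre ++ M :: suf).Nodup := by
      simp only [List.nodup_append, List.nodup_cons, List.mem_cons, hpre.2, hsuf.2,
        Finset.mem_sdiff, Finset.mem_insert]
      refine ⟨hpre.1, ⟨?_, hsuf.1⟩, ?_⟩
      · rintro (h | h)
        · exact hMM.ne' h
        · exact hMU (hS h)
      · rintro a ⟨ha, haS⟩ b hb rfl
        rcases hb with rfl | rfl | hb
        · exact hMU ha
        · exact hM'U ha
        · exact haS hb
    have hle : ∀ x ∈ pre ++ suf, x ≤ M' := by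
      intro x hx
      simp only [List.mem_append, hpre.2, hsuf.2, Finset.mem_sdiff, Finset.mem_insert] at hx
      rcases hx with hx | rfl | hx
      · exact (hU x hx.1).le
      · exact le_rfl
      · exact (hU x (hS hx)).le
    have hlt : ∀ x ∈ pre ++ suf, x < M := fun x hx => (hle x hx).trans_lt hMM
    have hs : M' ∈ suf := by simp [hsuf.2]
    refine ⟨?_, ?_, ?_⟩
    · rw [mem_Wd]
      refine ⟨hnd, fun x => ?_⟩
      subst hV
      simp only [List.mem_append, List.mem_cons, hpre.2, hsuf.2, Finset.mem_sdiff,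
        Finset.mem_insert]
      have := @hS x
      tauto
    · rw [nlc_split hnd hlt, hlen]
    · rw [good_split hnd hlt (by simp [hs]) hle]
      simp [hs]
  have hc : ∀ S ∈ U.powerset, (Gs (U \ S) (S.card + 1) q).card * (S.card + 1).factorial =
      (Gs (U \ S) (S.card + 1) q ×ˢ Wd (insert M' S)).card := by
    intro S hS
    rw [Finset.mem_powerset] at hS
    rw [Finset.card_product, card_Wd, Finset.card_insert_of_notMem (fun h => hM'U (hS h))]
  rw [Finset.sum_congr rfl hc, ← Finset.card_sigma]
  symm
  refine Finset.card_bij (fun (x : (_ : Finset α) × (List α × List α)) _ => x.2.1 ++ M :: x.2.2) ?_ ?_ ?_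
  · rintro ⟨S, pre, suf⟩ hx
    simp only [Finset.mem_sigma, Finset.mem_product, mem_Gs] at hx
    obtain ⟨hS, ⟨h1, h2, h3⟩, h4⟩ := hx
    obtain ⟨h5, h6, h7⟩ := hlist S hS pre h1 suf h4
    rw [mem_Gs]
    exact ⟨h5, by simp only [h6]; omega, h7.2 h3⟩
  · rintro ⟨S, pre, suf⟩ hx ⟨S', pre', suf'⟩ hx' heq
    simp only [Finset.mem_sigma, Finset.mem_product, mem_Gs] at hx hx'
    obtain ⟨hS, ⟨h1, h2, h3⟩, h4⟩ := hx
    obtain ⟨hS', ⟨h1', h2', h3'⟩, h4'⟩ := hx'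
    have hp : M ∉ pre := by
      rw [(mem_Wd.1 h1).2, Finset.mem_sdiff]; exact fun h => hMU h.1
    have hp' : M ∉ pre' := by
      rw [(mem_Wd.1 h1').2, Finset.mem_sdiff]; exact fun h => hMU h.1
    simp only at heq
    have hps : pre = pre' ∧ suf = suf' := by
      have h := List.append_eq_append_iff.1 heq
      rcases h with ⟨a, rfl, h⟩ | ⟨a, rfl, h⟩
      · cases a with
        | nil => simpa using h
        | cons b a => simp at h; simp [h.1] at hp'
      · cases a with
        | nil => simpa [eq_comm] using h
        | cons b a => simp at h; simp [h.1] at hp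
    obtain ⟨rfl, rfl⟩ := hps
    have : insert M' S = insert M' S' := by rw [← Wd_toFinset h4, ← Wd_toFinset h4']
    rw [Finset.mem_powerset] at hS hS'
    have : S = S' := by
      rw [← Finset.erase_insert (fun h => hM'U (hS h)), this,
        Finset.erase_insert (fun h => hM'U (hS' h))]
    subst this
    rfl
  · intro l hl
    rw [mem_Gs] at hl
    obtain ⟨hW, hl2, hl3⟩ := hl
    obtain ⟨hnd, hmem⟩ := mem_Wd.1 hW
    have hMl : M ∈ l := by rw [hmem, hV]; simp
    obtain ⟨pre, suf, rfl⟩ := List.append_of_mem hMl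
    have hmem2 : ∀ x, x ∈ pre ++ suf ↔ x = M' ∨ x ∈ U := by
      intro x
      have h1 := hmem x
      subst hV
      have h2 : x ∈ pre ++ suf → x ≠ M := by
        rintro h rfl
        rw [List.nodup_middle, List.nodup_cons] at hnd
        exact hnd.1 h
      simp only [List.mem_append, List.mem_cons, Finset.mem_insert] at *
      constructor
      · intro h
        have := h2 h
        tauto
      · rintro (rfl | h)
        · have := hMM.ne
          tauto
        · have : x ≠ M := by rintro rfl; exact hMU h
          tauto
    have hle : ∀ x ∈ pre ++ suf, x ≤ M' := by
      intro x hx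
      rcases (hmem2 x).1 hx with rfl | h
      · exact le_rfl
      · exact (hU x h).le
    have hg := (good_split hnd (fun x hx => (hle x hx).trans_lt hMM) ((hmem2 M').2 (Or.inl rfl)) hle).1 hl3
    have hndp := (List.nodup_append.1 hnd).1
    have hnds : suf.Nodup := (List.nodup_cons.1 (List.nodup_append.1 hnd).2.1).2
    have hdis : ∀ x ∈ pre, x ∉ suf := by
      intro x hx hx'
      simp only [List.nodup_append, List.mem_cons] at hnd
      exact hnd.2.2 x hx x (Or.inr hx') rfl
    have hS : suf.toFinset.erase M' ∈ U.powerset := by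
      rw [Finset.mem_powerset]
      intro x hx
      rw [Finset.mem_erase, List.mem_toFinset] at hx
      exact ((hmem2 x).1 (by simp [hx.2])).resolve_left hx.1
    have hpW : pre ∈ Wd (U \ suf.toFinset.erase M') := by
      rw [mem_Wd]
      refine ⟨hndp, fun x => ?_⟩
      have h1 := hmem2 x
      have h2 := hdis x
      have h3 := hg.2
      simp only [List.mem_append, Finset.mem_sdiff, Finset.mem_erase, List.mem_toFinset] at *
      grind
    have hsW : suf ∈ Wd (insert M' (suf.toFinset.erase M')) := by
      rw [mem_Wd, Finset.insert_erase (List.mem_toFinset.2 hg.2)]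
      exact ⟨hnds, by simp⟩
    obtain ⟨-, h6, -⟩ := hlist _ hS pre hpW suf hsW
    refine ⟨⟨suf.toFinset.erase M', pre, suf⟩, ?_, rfl⟩
    simp only [Finset.mem_sigma, Finset.mem_product, mem_Gs]
    exact ⟨hS, ⟨hpW, by omega, hg.1⟩, hsW⟩
end

noncomputable def Hc (n k q : ℕ) : ℕ := (Gs (Finset.univ : Finset (Fin n)) k q).card

theorem bnp_eq (n p : ℕ) : bnp n p = Hc n 0 (p + 1) := by
  unfold bnp Hc
  rw [← Nat.card_eq_finsetCard]
  refine Nat.card_eq_of_bijective (fun σ => ⟨permWord σ.1, ?_⟩) ⟨?_, ?_⟩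
  · rw [mem_Gs, mem_Wd]
    refine ⟨⟨permWord_nodup _, fun x => ?_⟩, (inBasis_iff_s8 p σ.1).1 σ.2⟩
    simp only [permWord, List.mem_ofFn, Finset.mem_univ, iff_true]
    exact σ.1.surjective x
  · rintro ⟨σ, _⟩ ⟨τ, _⟩ h
    simp only [Subtype.mk.injEq] at *
    exact permWord_inj h
  · rintro ⟨l, hl⟩
    have hl' := hl
    rw [mem_Gs] at hl'
    obtain ⟨σ, rfl⟩ := exists_permWord (mem_Wd.1 hl'.1).1 (by simpa using Wd_length hl'.1)
    exact ⟨⟨σ, (inBasis_iff_s8 p σ).2 hl'.2⟩, rfl⟩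

theorem Hc_zero {n k q : ℕ} (h : (0 < n ∧ n + k ≤ q) ∨ 2 * q < n + 2 * k ∨ n + k < q) : Hc n k q = 0 := by
  rw [Hc, Finset.card_eq_zero, Finset.eq_empty_iff_forall_notMem]
  intro l hl
  rw [mem_Gs] at hl
  obtain ⟨h1, h2, h3⟩ := hl
  have hnd := (mem_Wd.1 h1).1
  have hlen := Wd_length h1
  rw [Finset.card_univ, Fintype.card_fin] at hlen
  have h4 := good_le hnd h3
  by_cases hl : l = []
  · subst hl
    have : nlc ([] : List (Fin n)) = 0 := by
      rw [nlc, Finset.card_eq_zero]; simp [nls]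
    simp at hlen
    omega
  · have := nlc_lt hnd hl
    omega

theorem Hc_shift (n k q : ℕ) : Hc n k (q + k) = Hc n 0 q := by
  unfold Hc
  congr 1
  ext l
  simp only [mem_Gs]
  simp

theorem Hc_nil : Hc 0 0 0 = 1 := by
  unfold Hc
  rw [Finset.card_eq_one]
  refine ⟨[], ?_⟩
  ext l
  rw [mem_Gs, mem_Wd, Finset.mem_singleton]
  constructor
  · rintro ⟨⟨_, h⟩, _⟩
    exact List.eq_nil_iff_forall_not_mem.2 (fun x => x.elim0)
  · rintro rfl
    refine ⟨⟨List.nodup_nil, fun x => x.elim0⟩, ?_, fun x => x.elim0⟩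
    rw [nlc, Finset.card_eq_zero.2]; simp [nls]

theorem Hc_rec (m q : ℕ) : Hc (m + 2) 0 q =
    ∑ s ∈ Finset.range (m + 1), m.choose s * (Hc (m - s) (s + 1) q * (s + 1).factorial) := by
  have hcard : (Finset.univ \ {Fin.last (m + 1), (Fin.last m).castSucc} : Finset (Fin (m + 2))).card = m := by
    rw [Finset.card_sdiff_of_subset (Finset.subset_univ _), Finset.card_pair (Fin.castSucc_lt_last _).ne']
    simp
  have h := Gs_rec (α := Fin (m + 2)) (V := Finset.univ)
    (U := Finset.univ \ {Fin.last (m + 1), (Fin.last m).castSucc}) (M := Fin.last (m + 1))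
    (M' := (Fin.last m).castSucc) (Fin.castSucc_lt_last _) ?_ ?_ q
  · rw [Hc, h]
    have h2 := Finset.sum_powerset_apply_card (fun s => Hc (m - s) (s + 1) q * (s + 1).factorial)
      (x := Finset.univ \ {Fin.last (m + 1), (Fin.last m).castSucc})
    rw [hcard] at h2
    simp only [smul_eq_mul] at h2
    rw [← h2]
    refine Finset.sum_congr rfl fun S hS => ?_
    rw [Finset.mem_powerset] at hS
    rw [Gs_std, Finset.card_sdiff_of_subset hS, hcard, Hc]
  · intro x hx
    simp [Fin.ext_iff] at hx
    rw [Fin.lt_def]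
    simp
    omega
  · ext x
    simp
    tauto
/-- the recurrence for `b_{n,p}`:
`b_{n,p} = Σ_{ℓ=0}^{p−1} (ℓ+1)!·C(n−2,ℓ)·b_{n−ℓ−2,p−ℓ−1}` for `0 ≤ p < n−2`, anchored
with `b_{n,p} = 0` whenever `2p < n−2` or `p > n−2`, and `b_{n,n−2} = (n−1)!` for `n > 1`. -/
theorem bnp_recurrence :
    (∀ n p : ℕ, (p : ℤ) < (n : ℤ) - 2 →
      bnp n p = ∑ ℓ ∈ Finset.range p,
        (ℓ + 1).factorial * (n - 2).choose ℓ * bnp (n - ℓ - 2) (p - ℓ - 1)) ∧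
    (∀ n p : ℕ, (2 * p : ℤ) < (n : ℤ) - 2 ∨ (p : ℤ) > (n : ℤ) - 2 → bnp n p = 0) ∧
    (∀ n : ℕ, 1 < n → bnp n (n - 2) = (n - 1).factorial) := by
  refine ⟨?_, ?_, ?_⟩
  · intro n p h
    obtain ⟨m, rfl⟩ : ∃ m, n = m + 2 := ⟨n - 2, by omega⟩
    have hpm : p < m := by omega
    rw [bnp_eq, Hc_rec]
    rw [← Finset.sum_subset (Finset.range_subset_range.2 (by omega : p ≤ m + 1))]
    · refine Finset.sum_congr rfl fun s hs => ?_
      rw [Finset.mem_range] at hs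
      have h1 : p + 1 = (p - s) + (s + 1) := by omega
      rw [h1, Hc_shift, bnp_eq]
      have h2 : m + 2 - s - 2 = m - s := by omega
      have h3 : p - s - 1 + 1 = p - s := by omega
      rw [h2, h3, Nat.add_sub_cancel]
      ring
    · intro s hs hs'
      rw [Finset.mem_range] at hs hs'
      rw [Hc_zero]
      · simp
      · omega
  · intro n p h
    rw [bnp_eq]
    apply Hc_zero
    omega
  · intro n hn
    obtain ⟨m, rfl⟩ : ∃ m, n = m + 2 := ⟨n - 2, by omega⟩
    rw [bnp_eq, Hc_rec, Finset.sum_range_succ, Finset.sum_eq_zero]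
    · have : Hc (m - m) (m + 1) (m + 2 - 2 + 1) = 1 := by
        have := Hc_shift 0 (m + 1) 0
        rw [Hc_nil] at this
        simpa using this
      rw [this]
      simp
    · intro s hs
      rw [Finset.mem_range] at hs
      rw [Hc_zero]
      · simp
      · omega
end
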